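/- Let V be a finite-dimensional complex vector space, let F be a symmetric d-multilinear form on V, let L : V → V be a ℂ-linear map, let 2 ≤ k ≤ d, and let v, X₁, …, X_{k−1} ∈ V. Then the coefficient of t₁⋯t_{k−1} (equivalently, the mixed partial derivative ∂_{t₁}⋯∂_{t_{k−1}} at t = 0) of the polynomial function (t₁, …, t_{k−1}) ↦ F(L(v + ∑_i t_i X_i), v + ∑_i t_i X_i, …, v + ∑_i t_i X_i) equals ((d−1)!/(d−k)!) · F(L(v), X₁, …, X_{k−1}, v, …, v) + ∑_{j=1}^{k−1} ((d−1)!/(d−k+1)!) · F(L(X_j), X₁, …, X̂_j, …, X_{k−1}, v, …, v), where X̂_j means that X_j is omitted and the remaining slots are filled with v. -/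

import Mathlib

theorem ppl_continuous {V : Type*} [NormedAddCommGroup V] [NormedSpace ℂ V]
    [FiniteDimensional ℂ V] {d : ℕ}
    (F : MultilinearMap ℂ (fun _ : Fin d => V) ℂ) : Continuous F := by
  classical
  let b := Module.finBasis ℂ V
  have h : (F : (Fin d → V) → ℂ) = fun w => ∑ r : Fin d → Fin (Module.finrank ℂ V),
      (∏ i, b.coord (r i) (w i)) • F (fun i => b (r i)) := by
    funext w
    have hw : w = fun i => ∑ j, b.coord j (w i) • b j := by
      funext i
      simp [Module.Basis.coord_apply, b.sum_repr]
    conv_lhs => rw [hw]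
    rw [MultilinearMap.map_sum]
    refine Finset.sum_congr rfl fun r _ => ?_
    rw [MultilinearMap.map_smul_univ]
  rw [h]
  refine continuous_finsetSum _ fun r _ => ?_
  simp only [smul_eq_mul]
  refine Continuous.mul ?_ continuous_const
  refine continuous_finsetProd _ fun i _ => ?_
  have hc : Continuous (b.coord (r i)) := LinearMap.continuous_of_finiteDimensional _
  have hp : Continuous (fun w : Fin d → V => w i) := continuous_apply i
  exact hc.comp hp

/-- Slot-wise operation: `L` in slot `0`, identity elsewhere. -/
noncomputable def pplP {V : Type*} [AddCommGroup V] [Module ℂ V] {D : ℕ} (L : V →ₗ[ℂ] V)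
    (i : Fin (D + 1)) : V →ₗ[ℂ] V := if (i : ℕ) = 0 then L else LinearMap.id

open scoped Classical in
/-- The tuple attached to an embedding. -/
noncomputable def pplW {V : Type*} [AddCommGroup V] [Module ℂ V] {D n : ℕ} (L : V →ₗ[ℂ] V)
    (v : V) (X : Fin n → V) (e : Fin n ↪ Fin (D + 1)) (i : Fin (D + 1)) : V :=
  pplP L i (if h : i ∈ Set.range e then X (e.toEquivRange.symm ⟨i, h⟩) else v)

theorem pplW_mem {V : Type*} [AddCommGroup V] [Module ℂ V] {D n : ℕ} (L : V →ₗ[ℂ] V)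
    (v : V) (X : Fin n → V) (e : Fin n ↪ Fin (D + 1)) (j : Fin n) :
    pplW L v X e (e j) = pplP L (e j) (X j) := by
  classical
  simp [pplW]

theorem pplW_notMem {V : Type*} [AddCommGroup V] [Module ℂ V] {D n : ℕ} (L : V →ₗ[ℂ] V)
    (v : V) (X : Fin n → V) (e : Fin n ↪ Fin (D + 1)) (i : Fin (D + 1))
    (h : i ∉ Set.range e) :
    pplW L v X e i = pplP L i v := by
  classical
  simp only [pplW, dif_neg h]

theorem ppl_deriv {V : Type*} [NormedAddCommGroup V] [NormedSpace ℂ V]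
    [FiniteDimensional ℂ V] {D n : ℕ}
    (F : MultilinearMap ℂ (fun _ : Fin (D + 1) => V) ℂ) (L : V →ₗ[ℂ] V)
    (v : V) (X : Fin n → V) :
    iteratedFDeriv ℂ n
        (fun t : Fin n → ℂ =>
          F (fun i : Fin (D + 1) =>
            if (i : ℕ) = 0 then L (v + ∑ j : Fin n, t j • X j)
            else v + ∑ j : Fin n, t j • X j))
        0 (fun j : Fin n => Pi.single j (1 : ℂ)) =
      ∑ e : Fin n ↪ Fin (D + 1), F (pplW L v X e) := by
  classical
  let G : ContinuousMultilinearMap ℂ (fun _ : Fin (D + 1) => V) ℂ :=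
    ⟨F.compLinearMap (fun i => pplP L i), ppl_continuous _⟩
  let A : (Fin n → ℂ) →L[ℂ] (Fin (D + 1) → V) :=
    LinearMap.toContinuousLinearMap
      (LinearMap.pi fun _ => ∑ j : Fin n, (LinearMap.proj (R := ℂ) j).smulRight (X j))
  have hA : ∀ t i, A t i = ∑ j : Fin n, t j • X j := by
    intro t i
    simp [A]
  have hf : (fun t : Fin n → ℂ =>
          F (fun i : Fin (D + 1) =>
            if (i : ℕ) = 0 then L (v + ∑ j : Fin n, t j • X j)
            else v + ∑ j : Fin n, t j • X j)) =
      (fun y => G ((fun _ => v) + y)) ∘ A := by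
    funext t
    change _ = F (fun i => pplP L i (v + A t i))
    congr 1
    funext i
    rw [hA]
    unfold pplP
    split_ifs <;> rfl
  have hG : ContDiff ℂ n (fun y => G ((fun _ => v) + y)) :=
    G.contDiff.comp (contDiff_const.add contDiff_id)
  rw [hf, ContinuousLinearMap.iteratedFDeriv_comp_right A hG _ le_rfl,
    iteratedFDeriv_comp_add_left, G.iteratedFDeriv_eq]
  simp only [ContinuousMultilinearMap.iteratedFDeriv,
    ContinuousMultilinearMap.compContinuousLinearMap_apply, sum_apply,
    ContinuousMultilinearMap.iteratedFDerivComponent_apply, Pi.compRightL_apply]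
  refine Finset.sum_congr rfl fun e _ => ?_
  change F (fun i => pplP L i _) = _
  congr 1
  funext i
  unfold pplW
  congr 1
  split_ifs with h
  · rw [hA]
    obtain ⟨j, rfl⟩ := h
    simp [Pi.single_apply]
  · simp

theorem ppl_symm {V : Type*} [AddCommGroup V] [Module ℂ V] {D n : ℕ}
    (F : MultilinearMap ℂ (fun _ : Fin (D + 1) => V) ℂ)
    (hsym : ∀ (w : Fin (D + 1) → V) (σ : Equiv.Perm (Fin (D + 1))), F (w ∘ σ) = F w)
    (L : V →ₗ[ℂ] V) (v : V) (X : Fin n → V) (e e' : Fin n ↪ Fin (D + 1))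
    (σ : Equiv.Perm (Fin (D + 1))) (h0 : σ 0 = 0) (hσ : ∀ j, σ (e j) = e' j) :
    F (pplW L v X e) = F (pplW L v X e') := by
  rw [← hsym (pplW L v X e') σ]
  congr 1
  funext i
  have hP : pplP L (σ i) = pplP L i := by
    unfold pplP
    have : ((σ i : Fin (D + 1)) : ℕ) = 0 ↔ (i : ℕ) = 0 := by
      rw [Fin.val_eq_zero_iff, Fin.val_eq_zero_iff]
      constructor
      · intro h
        exact σ.injective (h.trans h0.symm)
      · rintro rfl
        exact h0
    simp only [this]
  by_cases hi : i ∈ Set.range e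
  · obtain ⟨j, rfl⟩ := hi
    rw [Function.comp_apply, pplW_mem, hσ, pplW_mem, ← hσ, hP]
  · rw [Function.comp_apply, pplW_notMem _ _ _ _ _ hi, pplW_notMem, hP]
    rintro ⟨j, hj⟩
    exact hi ⟨j, σ.injective (by rw [hσ, hj])⟩

theorem ppl_card_avoid {D n : ℕ} [DecidableEq (Fin n ↪ Fin (D + 1))] :
    (Finset.univ.filter fun e : Fin n ↪ Fin (D + 1) => ∀ j, e j ≠ 0).card
      = D.descFactorial n := by
  classical
  rw [← Fintype.card_subtype]
  have E : {e : Fin n ↪ Fin (D + 1) // ∀ j, e j ≠ 0} ≃ (Fin n ↪ {x : Fin (D + 1) // x ≠ 0}) :=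
    { toFun := fun e => ⟨fun j => ⟨e.1 j, e.2 j⟩, fun a b h => e.1.injective (by simpa using h)⟩
      invFun := fun g => ⟨g.trans (Function.Embedding.subtype _), fun j => (g j).2⟩
      left_inv := fun e => by ext; rfl
      right_inv := fun g => by ext; rfl }
  rw [Fintype.card_congr E, Fintype.card_embedding_eq]
  simp [Fintype.card_subtype_compl]

theorem ppl_card_hit {D n : ℕ} (j : Fin n) :
    (Finset.univ.filter fun e : Fin n ↪ Fin (D + 1) => e j = 0).card
      = D.descFactorial (n - 1) := by
  classical
  rw [← Fintype.card_subtype]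
  have E : {e : Fin n ↪ Fin (D + 1) // e j = 0} ≃
      ({i : Fin n // i ≠ j} ↪ {x : Fin (D + 1) // x ≠ 0}) :=
    { toFun := fun e => ⟨fun i => ⟨e.1 i.1, fun h => i.2 (e.1.injective (h.trans e.2.symm))⟩,
        fun a b h => Subtype.ext (e.1.injective (by simpa using h))⟩
      invFun := fun g => ⟨⟨fun i => if h : i = j then 0 else (g ⟨i, h⟩).1, by
        intro a b hab
        by_cases ha : a = j <;> by_cases hb : b = j
        · rw [ha, hb]
        · simp only [ha, hb, dif_pos, dif_neg, not_false_eq_true] at hab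
          exact absurd hab.symm (g ⟨b, hb⟩).2
        · simp only [ha, hb, dif_pos, dif_neg, not_false_eq_true] at hab
          exact absurd hab (g ⟨a, ha⟩).2
        · simp only [ha, hb, dif_neg, not_false_eq_true] at hab
          have := g.injective (Subtype.ext hab)
          simpa using this⟩, by simp⟩
      left_inv := fun e => by
        apply Subtype.ext
        ext i
        by_cases h : i = j
        · subst h
          simp [e.2]
        · simp only [Function.Embedding.coeFn_mk, dif_neg h]
          rfl
      right_inv := fun g => by
        ext i
        simp [i.2] }
  rw [Fintype.card_congr E, Fintype.card_embedding_eq]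
  simp [Fintype.card_subtype_compl]

/-- Standard embedding avoiding `0`. -/
def pplE1 {D n : ℕ} (h : n ≤ D) : Fin n ↪ Fin (D + 1) :=
  ⟨fun i => ⟨i + 1, by omega⟩, fun a b hab => by simpa [Fin.ext_iff] using hab⟩

theorem pplE1_val {D n : ℕ} (h : n ≤ D) (i : Fin n) :
    ((pplE1 h i : Fin (D + 1)) : ℕ) = i + 1 := rfl

/-- Standard embedding sending `j` to `0`. -/
def pplE2 {D n : ℕ} (h : n ≤ D) (j : Fin n) : Fin n ↪ Fin (D + 1) :=
  ⟨fun i => if i = j then 0 else ⟨i + 1, by omega⟩, fun a b hab => by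
    by_cases ha : a = j <;> by_cases hb : b = j <;> simp_all [Fin.ext_iff]⟩

theorem pplE2_self {D n : ℕ} (h : n ≤ D) (j : Fin n) : pplE2 h j j = 0 :=
  if_pos rfl

theorem pplE2_val {D n : ℕ} (h : n ≤ D) (j i : Fin n) (hi : i ≠ j) :
    ((pplE2 h j i : Fin (D + 1)) : ℕ) = i + 1 := by
  have : pplE2 h j i = ⟨i + 1, by omega⟩ := if_neg hi
  rw [this]

theorem ppl_sum {V : Type*} [AddCommGroup V] [Module ℂ V] {D n : ℕ} (hn : n ≤ D)
    (F : MultilinearMap ℂ (fun _ : Fin (D + 1) => V) ℂ)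
    (hsym : ∀ (w : Fin (D + 1) → V) (σ : Equiv.Perm (Fin (D + 1))), F (w ∘ σ) = F w)
    (L : V →ₗ[ℂ] V) (v : V) (X : Fin n → V) :
    ∑ e : Fin n ↪ Fin (D + 1), F (pplW L v X e) =
      (D.descFactorial n : ℂ) * F (pplW L v X (pplE1 hn)) +
      ∑ j : Fin n, (D.descFactorial (n - 1) : ℂ) * F (pplW L v X (pplE2 hn j)) := by
  classical
  have h1 : ∑ e ∈ Finset.univ.filter (fun e : Fin n ↪ Fin (D + 1) => ∀ j, e j ≠ 0),
      F (pplW L v X e) = (D.descFactorial n : ℂ) * F (pplW L v X (pplE1 hn)) := by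
    rw [Finset.sum_congr rfl (g := fun _ => F (pplW L v X (pplE1 hn))), Finset.sum_const,
      ppl_card_avoid, nsmul_eq_mul]
    intro e he
    rw [Finset.mem_filter] at he
    obtain ⟨σ, hσ⟩ := Equiv.Perm.exists_extending_pair
      (Fin.cons 0 e : Fin (n + 1) → Fin (D + 1)) (Fin.cons 0 (pplE1 hn))
      (Fin.cons_injective_iff.2 ⟨by rintro ⟨j, hj⟩; exact he.2 j hj, e.injective⟩)
      (Fin.cons_injective_iff.2 ⟨by rintro ⟨j, hj⟩; have := congrArg Fin.val hj; rw [pplE1_val] at this; simp at this,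
        (pplE1 hn).injective⟩)
    exact ppl_symm F hsym L v X _ _ σ (by simpa using hσ 0) (fun j => by simpa using hσ j.succ)
  have h2 : ∀ j, ∑ e ∈ Finset.univ.filter (fun e : Fin n ↪ Fin (D + 1) => e j = 0),
      F (pplW L v X e) = (D.descFactorial (n - 1) : ℂ) * F (pplW L v X (pplE2 hn j)) := by
    intro j
    rw [Finset.sum_congr rfl (g := fun _ => F (pplW L v X (pplE2 hn j))), Finset.sum_const,
      ppl_card_hit, nsmul_eq_mul]
    intro e he
    rw [Finset.mem_filter] at he
    obtain ⟨σ, hσ⟩ := Equiv.Perm.exists_extending_pair e (pplE2 hn j) e.injective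
      (pplE2 hn j).injective
    refine ppl_symm F hsym L v X _ _ σ ?_ hσ
    have := hσ j
    rw [he.2] at this
    rw [this, pplE2_self]
  rw [← h1, ← Finset.sum_congr rfl (fun j _ => h2 j)]
  rw [← Finset.sum_filter_add_sum_filter_not Finset.univ
    (fun e : Fin n ↪ Fin (D + 1) => ∀ j, e j ≠ 0)]
  congr 1
  rw [← Finset.sum_biUnion]
  · refine Finset.sum_congr ?_ fun _ _ => rfl
    ext e
    simp
  · intro a _ b _ hab
    rw [Function.onFun, Finset.disjoint_left]
    intro e ha hb
    rw [Finset.mem_filter] at ha hb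
    exact hab (e.injective (ha.2.trans hb.2.symm))

theorem pplW_E1 {V : Type*} [AddCommGroup V] [Module ℂ V] {D n : ℕ} (hn : n ≤ D)
    (L : V →ₗ[ℂ] V) (v : V) (X : Fin n → V) :
    pplW L v X (pplE1 hn) = fun i : Fin (D + 1) =>
            if (i : ℕ) = 0 then L v
            else if h : (i : ℕ) - 1 < n then X ⟨(i : ℕ) - 1, h⟩ else v := by
  funext i
  by_cases hi : i ∈ Set.range (pplE1 hn)
  · obtain ⟨j, rfl⟩ := hi
    rw [pplW_mem]
    simp [pplP, pplE1_val, -Fin.val_eq_zero_iff]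
  · rw [pplW_notMem _ _ _ _ _ hi]
    by_cases h0 : (i : ℕ) = 0
    · simp [pplP, h0]
    · have : ¬ (i : ℕ) - 1 < n := fun h => hi ⟨⟨(i : ℕ) - 1, h⟩, by
        rw [Fin.ext_iff, pplE1_val]; simp only; omega⟩
      simp [pplP, h0, this]

theorem pplW_E2 {V : Type*} [AddCommGroup V] [Module ℂ V] {D n : ℕ} (hn : n ≤ D)
    (L : V →ₗ[ℂ] V) (v : V) (X : Fin n → V) (j : Fin n) :
    pplW L v X (pplE2 hn j) = fun i : Fin (D + 1) =>
            if (i : ℕ) = 0 then L (X j)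
            else if h : (i : ℕ) - 1 < n then
                (if (⟨(i : ℕ) - 1, h⟩ : Fin n) = j then v
                 else X ⟨(i : ℕ) - 1, h⟩)
            else v := by
  funext i
  by_cases hi : i ∈ Set.range (pplE2 hn j)
  · obtain ⟨a, rfl⟩ := hi
    rw [pplW_mem]
    by_cases ha : a = j
    · subst ha
      simp [pplP, pplE2_self]
    · simp [pplP, pplE2_val hn j a ha, ha, -Fin.val_eq_zero_iff]
  · rw [pplW_notMem _ _ _ _ _ hi]
    by_cases h0 : (i : ℕ) = 0
    · exact absurd ⟨j, by rw [pplE2_self, Fin.ext_iff, h0]; rfl⟩ hi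
    · by_cases h : (i : ℕ) - 1 < n
      · by_cases hj : (⟨(i : ℕ) - 1, h⟩ : Fin n) = j
        · simp only [pplP, h0, h, hj, if_true, if_false, dif_pos, LinearMap.id_apply]
        · refine absurd ⟨⟨(i : ℕ) - 1, h⟩, ?_⟩ hi
          rw [Fin.ext_iff, pplE2_val hn j _ hj]; simp only; omega
      · simp [pplP, h0, h]


/-- Let `V` be a finite-dimensional complex vector space, `F` a symmetric
`d`-multilinear form on `V`, `L : V → V` linear, `2 ≤ k ≤ d`, and
`v, X₁, …, X_{k−1} ∈ V`.  Then the coefficient of `t₁⋯t_{k−1}` (the mixed partial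
derivative `∂_{t₁}⋯∂_{t_{k−1}}` at `t = 0`) of
`(t₁, …, t_{k−1}) ↦ F(L(v + ∑ tᵢXᵢ), v + ∑ tᵢXᵢ, …, v + ∑ tᵢXᵢ)` equals
`((d−1)!/(d−k)!)·F(L(v), X₁, …, X_{k−1}, v, …, v)
  + ∑_j ((d−1)!/(d−k+1)!)·F(L(X_j), X₁, …, X̂_j, …, X_{k−1}, v, …, v)`. -/
theorem polarisation_projection_lemma
    {V : Type*} [NormedAddCommGroup V] [NormedSpace ℂ V] [FiniteDimensional ℂ V]
    {d : ℕ}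
    (F : MultilinearMap ℂ (fun _ : Fin d => V) ℂ)
    (hsym : ∀ (w : Fin d → V) (σ : Equiv.Perm (Fin d)), F (w ∘ σ) = F w)
    (L : V →ₗ[ℂ] V)
    {k : ℕ} (hk2 : 2 ≤ k) (hkd : k ≤ d)
    (v : V) (X : Fin (k - 1) → V) :
    iteratedFDeriv ℂ (k - 1)
        (fun t : Fin (k - 1) → ℂ =>
          F (fun i : Fin d =>
            if (i : ℕ) = 0 then L (v + ∑ j : Fin (k - 1), t j • X j)
            else v + ∑ j : Fin (k - 1), t j • X j))
        0 (fun j : Fin (k - 1) => Pi.single j (1 : ℂ)) =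
      ((Nat.factorial (d - 1) / Nat.factorial (d - k) : ℕ) : ℂ) *
          F (fun i : Fin d =>
            if (i : ℕ) = 0 then L v
            else if h : (i : ℕ) - 1 < k - 1 then X ⟨(i : ℕ) - 1, h⟩ else v) +
        ∑ j : Fin (k - 1),
          ((Nat.factorial (d - 1) / Nat.factorial (d - k + 1) : ℕ) : ℂ) *
            F (fun i : Fin d =>
              if (i : ℕ) = 0 then L (X j)
              else if h : (i : ℕ) - 1 < k - 1 then
                (if (⟨(i : ℕ) - 1, h⟩ : Fin (k - 1)) = j then v
                 else X ⟨(i : ℕ) - 1, h⟩)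
              else v) := by

  obtain ⟨D, rfl⟩ : ∃ D, d = D + 1 := ⟨d - 1, by omega⟩
  have hn : k - 1 ≤ D := by omega
  rw [ppl_deriv, ppl_sum hn F hsym, pplW_E1]
  simp only [pplW_E2]
  have e1 : D.descFactorial (k - 1) = Nat.factorial (D + 1 - 1) / Nat.factorial (D + 1 - k) := by
    rw [Nat.descFactorial_eq_div hn, show D - (k - 1) = D + 1 - k by omega]
    rfl
  have e2 : D.descFactorial (k - 1 - 1)
      = Nat.factorial (D + 1 - 1) / Nat.factorial (D + 1 - k + 1) := by
    rw [Nat.descFactorial_eq_div (by omega), show D - (k - 1 - 1) = D + 1 - k + 1 by omega]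
    rfl
  rw [e1, e2]
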